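/- arXiv:1106.0463 — 2 statements merged into one kernel-verified Lean document; each statement's English description precedes it below -/
import Mathlib

section
/- For every integer n ≥ 0 and every x ∈ (0, π), the Legendre polynomial satisfies the Dirichlet–Murphy integral representation P_n(cos x) = -(i/π) ∫_x^{2π-x} e^{i(n+1/2)y} / √(2(cos x − cos y)) dy. -/
open MeasureTheory Real intervalIntegral

/-- The `n`-th Legendre polynomial, via the Rodrigues formula. -/
noncomputable def legendre (n : ℕ) : Polynomial ℝ :=
  (1 / (2 ^ n * n.factorial) : ℝ) • (Polynomial.derivative^[n] ((Polynomial.X ^ 2 - 1) ^ n))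


theorem dm_sum_rec (z : ℝ) (n N : ℕ) (h : n + 2 < N) :
    ∑ k ∈ Finset.range N, (-4 : ℝ)^k * ((n+2+k).choose (2*k)) * z^k =
    (2 - 4*z) * ∑ k ∈ Finset.range N, (-4 : ℝ)^k * ((n+1+k).choose (2*k)) * z^k
     - ∑ k ∈ Finset.range N, (-4 : ℝ)^k * ((n+k).choose (2*k)) * z^k := by
  obtain ⟨M, rfl⟩ : ∃ M, N = M + 1 := ⟨N-1, by omega⟩
  have h1 : (-4*z) * ∑ k ∈ Finset.range (M+1), (-4 : ℝ)^k * ((n+1+k).choose (2*k)) * z^k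
      = ∑ k ∈ Finset.range M, (-4 : ℝ)^(k+1) * ((n+1+k).choose (2*k)) * z^(k+1) := by
    rw [Finset.sum_range_succ, Nat.choose_eq_zero_of_lt (show n+1+M < 2*M by omega)]
    rw [Nat.cast_zero, mul_zero, zero_mul, add_zero, Finset.mul_sum]
    refine Finset.sum_congr rfl fun k _ => by ring
  have e : ∀ S : ℝ, (2-4*z)*S = 2*S + (-4*z)*S := fun S => by ring
  rw [e, h1]
  simp only [Finset.sum_range_succ' _ M]
  have : ∀ k, (-4 : ℝ)^(k+1) * ((n+2+(k+1)).choose (2*(k+1))) * z^(k+1) =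
     2 * ((-4 : ℝ)^(k+1) * ((n+1+(k+1)).choose (2*(k+1))) * z^(k+1))
     + (-4 : ℝ)^(k+1) * ((n+1+k).choose (2*k)) * z^(k+1)
     - (-4 : ℝ)^(k+1) * ((n+(k+1)).choose (2*(k+1))) * z^(k+1) := by
    intro k
    have c : (n+2+(k+1)).choose (2*(k+1)) + (n+(k+1)).choose (2*(k+1)) =
      2 * (n+1+(k+1)).choose (2*(k+1)) + (n+1+k).choose (2*k) := by
      have a1 : (n+2+(k+1)).choose (2*(k+1)) = (n+k+2).choose (2*k+1) + (n+k+2).choose (2*k+2) := by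
        rw [← Nat.choose_succ_succ']; congr 1; omega
      have a2 : (n+k+2).choose (2*k+1) = (n+k+1).choose (2*k) + (n+k+1).choose (2*k+1) := 
        Nat.choose_succ_succ' _ _
      have a3 : (n+k+2).choose (2*k+2) = (n+k+1).choose (2*k+1) + (n+k+1).choose (2*k+2) := 
        Nat.choose_succ_succ' _ _
      have b1 : (n+(k+1)).choose (2*(k+1)) = (n+k+1).choose (2*k+2) := by congr 1
      have b2 : (n+1+(k+1)).choose (2*(k+1)) = (n+k+2).choose (2*k+2) := by congr 1; omega
      have b3 : (n+1+k).choose (2*k) = (n+k+1).choose (2*k) := by congr 1; omega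
      omega
    have c' := congrArg (Nat.cast : ℕ → ℝ) c
    push_cast at c'
    linear_combination (-4 : ℝ)^(k+1) * z^(k+1) * c'
  rw [Finset.sum_congr rfl fun k _ => this k]
  rw [Finset.sum_sub_distrib, Finset.sum_add_distrib, ← Finset.mul_sum]
  simp only [mul_zero, Nat.choose_zero_right, pow_zero, Nat.cast_one]
  ring

theorem dm_cos (φ : ℝ) (N : ℕ) : ∀ n : ℕ, n < N → cos ((2*n+1)*φ) =
    cos φ * ∑ k ∈ Finset.range N, (-4 : ℝ)^k * ((n+k).choose (2*k)) * (sin φ ^2)^k := by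
  intro n
  induction n using Nat.twoStepInduction with
  | zero =>
    intro h
    rw [Finset.sum_eq_single 0]
    · simp
    · intro k _ hk
      rw [Nat.choose_eq_zero_of_lt (by omega)]; simp
    · intro h'; simp at h'; omega
  | one =>
    intro h
    rw [← Finset.sum_subset (s₁ := Finset.range 2)]
    · simp [Finset.sum_range_succ]
      rw [show (2+1)*φ = 3*φ by ring, cos_three_mul]
      have := sin_sq_add_cos_sq φ
      linear_combination (4 * cos φ) * this
    · intro k hk; simp at *; omega
    · intro k _ hk
      simp at hk
      rw [Nat.choose_eq_zero_of_lt (by omega)]; simp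
  | more n ih1 ih2 =>
    intro h
    rw [dm_sum_rec _ _ _ h]
    have h1 := ih1 (by omega)
    have h2 := ih2 (by omega)
    have e : cos ((2*(n+2:ℕ)+1)*φ) = 2 * cos (2*φ) * cos ((2*(n+1:ℕ)+1)*φ) - cos ((2*n+1)*φ) := by
      have e1 : (2*(n+2:ℕ)+1)*φ = (2*(n+1:ℕ)+1)*φ + 2*φ := by push_cast; ring
      have e2 : (2*n+1)*φ = (2*(n+1:ℕ)+1)*φ - 2*φ := by push_cast; ring
      rw [e1, e2, cos_add, cos_sub]; ring
    rw [e, h1, h2, cos_two_mul, cos_sq']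
    ring

theorem dm_sin_pow (k : ℕ) : ∫ t in (-(π/2))..(π/2), sin t ^ (2*k) = π * k.centralBinom / 4^k := by
  have hp : Function.Periodic (fun t => sin t ^ (2*k)) π := by
    intro t
    simp [pow_mul]
  have := hp.intervalIntegral_add_eq (-(π/2)) 0
  rw [show -(π/2)+π = π/2 by ring, zero_add] at this
  rw [this, integral_sin_pow_even, mul_div_assoc]
  congr 1
  induction k with
  | zero => simp
  | succ k ih =>
    have hp : Function.Periodic (fun t => sin t ^ (2*k)) π := by
      intro t
      simp [pow_mul]
    have := hp.intervalIntegral_add_eq (-(π/2)) 0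
    rw [show -(π/2)+π = π/2 by ring, zero_add] at this
    rw [Finset.prod_range_succ, ih hp this]
    have c := congrArg (Nat.cast : ℕ → ℝ) (Nat.succ_mul_centralBinom_succ k)
    push_cast at c
    field_simp
    rw [pow_succ]
    linear_combination (-2) * 4^k * c

theorem dm_choose (n k : ℕ) : (n+k).choose (2*k) * k.centralBinom = n.choose k * (n+k).choose n := by
  by_cases h : n < k
  · rw [Nat.choose_eq_zero_of_lt h, Nat.choose_eq_zero_of_lt (show n+k < 2*k by omega)]; simp
  · push Not at h
    rw [Nat.centralBinom, Nat.choose_mul (by omega)]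
    rw [show 2*k-k = k by omega, show n+k-k = n by omega, mul_comm, Nat.choose_symm_add]

theorem dm_int (n : ℕ) (c : ℝ) : ∫ t in (-(π/2))..(π/2),
     ∑ k ∈ Finset.range (n+1), (-4 : ℝ)^k * ((n+k).choose (2*k)) * ((c * sin t) ^2)^k
     = π * ∑ k ∈ Finset.range (n+1), (-1:ℝ)^k * n.choose k * (n+k).choose n * (c^2)^k := by
  rw [intervalIntegral.integral_finsetSum, Finset.mul_sum]
  · refine Finset.sum_congr rfl fun k _ => ?_
    have : ∀ t : ℝ, (-4 : ℝ)^k * ((n+k).choose (2*k)) * ((c * sin t) ^2)^k =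
      ((-4 : ℝ)^k * ((n+k).choose (2*k)) * (c^2)^k) * sin t ^ (2*k) := fun t => by ring
    simp only [this]
    rw [intervalIntegral.integral_const_mul, dm_sin_pow]
    have c' := congrArg (Nat.cast : ℕ → ℝ) (dm_choose n k)
    push_cast at c'
    rw [show (-4:ℝ) = (-1)*4 by norm_num, mul_pow]
    field_simp
    linear_combination  (c^2)^k * c'
  · intro k _
    apply Continuous.intervalIntegrable
    fun_prop

theorem dm_iter (p : Polynomial ℝ) (k : ℕ) :
    Polynomial.derivative^[k] (p.comp (2 * Polynomial.X - 1)) =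
      2^k * (Polynomial.derivative^[k] p).comp (2 * Polynomial.X - 1) := by
  induction k with
  | zero => simp
  | succ k ih =>
    rw [Function.iterate_succ_apply', ih, Function.iterate_succ_apply']
    have h2 : Polynomial.derivative ((2:Polynomial ℝ)^k) = 0 := by
      have : ((2:Polynomial ℝ)^k) = Polynomial.C (2^k) := by rw [Polynomial.C_pow]; rfl
      rw [this, Polynomial.derivative_C]
    have h3 : Polynomial.derivative (2 * Polynomial.X - 1 : Polynomial ℝ) = 2 := by simp
    rw [Polynomial.derivative_mul, h2, Polynomial.derivative_comp, h3]
    ring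

theorem dm_legendre (n : ℕ) (u : ℝ) : (legendre n).eval (2*u-1) =
    (-1)^n * ∑ k ∈ Finset.range (n+1), (-1:ℝ)^k * n.choose k * (n+k).choose n * u^k := by
  have h := congrArg (Polynomial.map (Int.castRingHom ℝ)) (Polynomial.factorial_mul_shiftedLegendre_eq n)
  rw [← Polynomial.iterate_derivative_map] at h
  simp only [Polynomial.map_mul, Polynomial.map_pow, Polynomial.map_sub, Polynomial.map_X,
    Polynomial.map_one, Polynomial.map_natCast] at h
  have hs : (Polynomial.map (Int.castRingHom ℝ) (Polynomial.shiftedLegendre n)).eval u =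
     ∑ k ∈ Finset.range (n+1), (-1:ℝ)^k * n.choose k * (n+k).choose n * u^k := by
    rw [Polynomial.shiftedLegendre, Polynomial.map_sum, Polynomial.eval_finsetSum]
    refine Finset.sum_congr rfl fun k _ => by simp
  rw [← hs]
  have h1 := dm_iter ((Polynomial.X ^ 2 - 1) ^ n) n
  have h2 : (((Polynomial.X : Polynomial ℝ) ^ 2 - 1) ^ n).comp (2 * Polynomial.X - 1) =
      Polynomial.C ((-4)^n) * (Polynomial.X ^ n * (1 - Polynomial.X) ^ n) := by
    simp only [Polynomial.pow_comp, Polynomial.sub_comp, Polynomial.X_comp, Polynomial.one_comp,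
      Polynomial.C_pow, ← mul_pow]
    congr 1
    have : (Polynomial.C (-4:ℝ)) = -4 := by rw [Polynomial.C_neg]; rfl
    rw [this]
    ring
  rw [h2, Polynomial.iterate_derivative_C_mul, ← h] at h1
  have h3 := congrArg (Polynomial.eval u) h1
  simp only [Polynomial.eval_mul, Polynomial.eval_C, Polynomial.eval_natCast, Polynomial.eval_pow,
    Polynomial.eval_comp, Polynomial.eval_sub, Polynomial.eval_X, Polynomial.eval_one,
    Polynomial.eval_ofNat] at h3
  rw [legendre, Polynomial.eval_smul, smul_eq_mul]
  have hn : (n.factorial : ℝ) ≠ 0 := by positivity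
  have e : ((-4:ℝ))^n = (-1)^n * 2^n * 2^n := by rw [← mul_pow, ← mul_pow]; norm_num
  rw [e] at h3
  rw [one_div, inv_mul_eq_iff_eq_mul₀ (by positivity)]
  apply mul_left_cancel₀ (show (2:ℝ)^n ≠ 0 by positivity)
  rw [← h3]; ring

theorem dm_main_sub (n : ℕ) (x : ℝ) (hx : x ∈ Set.Ioo 0 π) :
   (∫ y in x..(2 * π - x),
        Complex.exp (Complex.I * (n + 1 / 2) * y) /
          (Real.sqrt (2 * (Real.cos x - Real.cos y)) : ℂ)) =
   ∫ t in (-(π/2))..(π/2), Complex.exp (Complex.I * (n + 1 / 2) * (π + 2 * arcsin (cos (x/2) * sin t) : ℝ))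
      / (cos (arcsin (cos (x/2) * sin t)) : ℝ) := by
  obtain ⟨hx0, hx1⟩ := hx
  have hc0 : 0 < cos (x/2) := cos_pos_of_mem_Ioo ⟨by linarith, by linarith⟩
  have hc1 : cos (x/2) < 1 := by
    rw [← cos_zero]; exact cos_lt_cos_of_nonneg_of_le_pi (le_refl _) (by linarith) (by linarith)
  have hcs : cos (x/2) = sin ((π - x)/2) := by
    rw [← cos_pi_div_two_sub]; congr 1; ring
  set c := cos (x/2) with hc
  have hb : ∀ t, |c * sin t| < 1 := fun t => by
    rw [abs_mul, abs_of_pos hc0]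
    calc c * |sin t| ≤ c * 1 := by gcongr; exact abs_sin_le_one t
      _ < 1 := by linarith
  have hb1 : ∀ t, -1 < c * sin t := fun t => (abs_lt.1 (hb t)).1
  have hb2 : ∀ t, c * sin t < 1 := fun t => (abs_lt.1 (hb t)).2
  have hcp : ∀ t, 0 < cos (arcsin (c * sin t)) := fun t => by
    rw [cos_arcsin]
    apply sqrt_pos.2
    nlinarith [hb1 t, hb2 t]
  let f : ℝ → ℝ := fun t => π + 2 * arcsin (c * sin t)
  let f' : ℝ → ℝ := fun t => 2 * c * cos t / cos (arcsin (c * sin t))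
  let S : Set ℝ := Set.Ioo (-(π/2)) (π/2)
  have hder : ∀ t ∈ S, HasDerivWithinAt f (f' t) S t := by
    intro t _
    have h1 := (hasDerivAt_arcsin (hb1 t).ne' (hb2 t).ne)
    have h2 := ((hasDerivAt_sin t).const_mul c)
    have h3 := ((h1.comp t h2).const_mul 2).const_add π
    have h4 : HasDerivAt f (f' t) t := by
      refine h3.congr_deriv ?_
      simp only [f', cos_arcsin]
      ring
    exact h4.hasDerivWithinAt
  have harc : ∀ t, sin (arcsin (c * sin t)) = c * sin t := fun t =>
    sin_arcsin (hb1 t).le (hb2 t).le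
  have hinj : Set.InjOn f S := by
    intro a ha b hb' hab
    have h1 : arcsin (c * sin a) = arcsin (c * sin b) := by
      simp only [f] at hab; linarith
    have h2 := congrArg sin h1
    rw [harc, harc] at h2
    exact injOn_sin ⟨ha.1.le, ha.2.le⟩ ⟨hb'.1.le, hb'.2.le⟩ (mul_left_cancel₀ hc0.ne' h2)
  have himg : f '' S = Set.Ioo x (2*π - x) := by
    ext y
    constructor
    · rintro ⟨t, ht, rfl⟩
      have s1 : sin t < 1 := by
        rw [← sin_pi_div_two]; exact sin_lt_sin_of_lt_of_le_pi_div_two ht.1.le le_rfl ht.2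
      have s2 : -1 < sin t := by
        rw [← sin_pi_div_two, ← sin_neg]; exact sin_lt_sin_of_lt_of_le_pi_div_two le_rfl ht.2.le ht.1
      have a1 : arcsin (c * sin t) < (π - x)/2 := by
        rw [arcsin_lt_iff_lt_sin' ⟨by linarith, by linarith⟩, ← hcs]
        nlinarith
      have a2 : -((π - x)/2) < arcsin (c * sin t) := by
        rw [lt_arcsin_iff_sin_lt' ⟨by linarith, by linarith⟩, sin_neg, ← hcs]
        nlinarith
      constructor <;> simp only [f] <;> linarith
    · rintro ⟨h1, h2⟩
      have b1 : sin ((y-π)/2) < c := by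
        rw [hcs]; exact sin_lt_sin_of_lt_of_le_pi_div_two (by linarith) (by linarith) (by linarith)
      have b2 : -c < sin ((y-π)/2) := by
        rw [hcs, ← sin_neg]; exact sin_lt_sin_of_lt_of_le_pi_div_two (by linarith) (by linarith) (by linarith)
      have b3 : sin ((y-π)/2)/c < 1 := by rw [div_lt_one hc0]; exact b1
      have b4 : -1 < sin ((y-π)/2)/c := by rw [lt_div_iff₀ hc0]; linarith
      refine ⟨arcsin (sin ((y-π)/2)/c), ⟨?_, ?_⟩, ?_⟩
      · exact neg_pi_div_two_lt_arcsin.2 b4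
      · exact arcsin_lt_pi_div_two.2 b3
      · simp only [f]
        rw [sin_arcsin b4.le b3.le, mul_div_cancel₀ _ hc0.ne', arcsin_sin (by linarith) (by linarith)]
        ring
  have key := integral_image_eq_integral_abs_deriv_smul (measurableSet_Ioo : MeasurableSet S) hder hinj
    (fun y : ℝ => Complex.exp (Complex.I * (n + 1 / 2) * y) /
          (Real.sqrt (2 * (Real.cos x - Real.cos y)) : ℂ))
  rw [himg] at key
  rw [intervalIntegral.integral_of_le (by linarith), integral_Ioc_eq_integral_Ioo, key,
    intervalIntegral.integral_of_le (by linarith [pi_pos]), integral_Ioc_eq_integral_Ioo]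
  refine setIntegral_congr_fun measurableSet_Ioo fun t ht => ?_
  have hct : 0 < cos t := cos_pos_of_mem_Ioo ht
  have hf'pos : 0 < f' t := div_pos (by positivity) (hcp t)
  have hsq : √(2 * (cos x - cos (f t))) = 2 * c * cos t := by
    rw [← sqrt_sq (show 0 ≤ 2 * c * cos t by positivity)]
    congr 1
    have e1 : cos (f t) = -(1 - 2 * (c * sin t)^2) := by
      simp only [f]
      rw [add_comm, cos_add_pi, cos_two_mul, cos_sq', harc]; ring
    have e2 : cos x = 2 * c^2 - 1 := by
      rw [hc, ← cos_two_mul]; congr 1; ring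
    rw [e1, e2]
    linear_combination (-4 * c^2) * (sin_sq_add_cos_sq t)
  beta_reduce
  rw [abs_of_pos hf'pos, hsq, Complex.real_smul]
  simp only [f', f]
  have q1 : (c:ℂ) ≠ 0 := by exact_mod_cast hc0.ne'
  have q2 : (cos t:ℂ) ≠ 0 := by exact_mod_cast hct.ne'
  have q3 : (cos (arcsin (c * sin t)):ℂ) ≠ 0 := by exact_mod_cast (hcp t).ne'
  push_cast at q2 q3 ⊢
  field_simp

theorem dm_odd (g : ℝ → ℝ) (hg : ∀ t, g (-t) = - g t) (a : ℝ) : ∫ t in (-a)..a, g t = 0 := by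
  have h := intervalIntegral.integral_comp_neg (a := -a) (b := a) g
  simp only [hg, neg_neg, intervalIntegral.integral_neg] at h
  linarith

theorem dm_main_eval (n : ℕ) (c : ℝ) (hc0 : 0 < c) (hc1 : c < 1) :
   (∫ t in (-(π/2))..(π/2), Complex.exp (Complex.I * (n + 1 / 2) * (π + 2 * arcsin (c * sin t) : ℝ))
      / (cos (arcsin (c * sin t)) : ℝ)) = Complex.I * (-1)^n * 
      ((π * ∑ k ∈ Finset.range (n+1), (-1:ℝ)^k * n.choose k * (n+k).choose n * (c^2)^k : ℝ) : ℂ) := by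
  have hb : ∀ t, |c * sin t| < 1 := fun t => by
    rw [abs_mul, abs_of_pos hc0]
    calc c * |sin t| ≤ c * 1 := by gcongr; exact abs_sin_le_one t
      _ < 1 := by linarith
  have hb1 : ∀ t, -1 < c * sin t := fun t => (abs_lt.1 (hb t)).1
  have hb2 : ∀ t, c * sin t < 1 := fun t => (abs_lt.1 (hb t)).2
  have hcp : ∀ t, 0 < cos (arcsin (c * sin t)) := fun t => by
    rw [cos_arcsin]
    apply sqrt_pos.2
    nlinarith [hb1 t, hb2 t]
  have harc : ∀ t, sin (arcsin (c * sin t)) = c * sin t := fun t =>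
    sin_arcsin (hb1 t).le (hb2 t).le
  let A : ℝ → ℝ := fun t => ∑ k ∈ Finset.range (n+1), (-4 : ℝ)^k * ((n+k).choose (2*k)) * ((c * sin t) ^2)^k
  let B : ℝ → ℝ := fun t => sin ((2*n+1) * arcsin (c * sin t)) / cos (arcsin (c * sin t))
  have hA : Continuous A := by fun_prop
  have hB : Continuous B := by
    apply Continuous.div
    · fun_prop
    · fun_prop
    · exact fun t => (hcp t).ne'
  have hint : ∀ t : ℝ, Complex.exp (Complex.I * (n + 1 / 2) * (π + 2 * arcsin (c * sin t) : ℝ))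
      / (cos (arcsin (c * sin t)) : ℝ) = (Complex.I * (-1)^n) * ((A t : ℂ) + (B t : ℂ) * Complex.I) := by
    intro t
    have hA' : A t = cos ((2*n+1) * arcsin (c * sin t)) / cos (arcsin (c * sin t)) := by
      rw [dm_cos _ (n+1) n (by omega), harc, mul_div_cancel_left₀ _ (hcp t).ne']
    rw [hA']
    simp only [B]
    have q3 : ((cos (arcsin (c * sin t)) : ℝ):ℂ) ≠ 0 := by exact_mod_cast (hcp t).ne'
    set φ := arcsin (c * sin t)
    have e : Complex.I * (n + 1 / 2) * (π + 2 * φ : ℝ) = n * (π * Complex.I) + (π/2 * Complex.I +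
       ((2*n+1)*φ : ℝ) * Complex.I) := by push_cast; ring
    rw [e, Complex.exp_add, Complex.exp_add, Complex.exp_nat_mul, Complex.exp_pi_mul_I,
      Complex.exp_pi_div_two_mul_I, Complex.exp_mul_I, ← Complex.ofReal_cos, ← Complex.ofReal_sin,
      Complex.ofReal_div, Complex.ofReal_div]
    field_simp
  simp only [hint]
  rw [intervalIntegral.integral_const_mul, intervalIntegral.integral_add,
    intervalIntegral.integral_mul_const, intervalIntegral.integral_ofReal,
    intervalIntegral.integral_ofReal, dm_odd B]
  · simp only [A]
    rw [dm_int]; simp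
  · intro t; simp [B, neg_div]
  · exact (Complex.continuous_ofReal.comp hA).intervalIntegrable _ _
  · exact ((Complex.continuous_ofReal.comp hB).mul continuous_const).intervalIntegrable _ _

theorem dirichlet_murphy (n : ℕ) (x : ℝ) (hx : x ∈ Set.Ioo 0 π) :
    (((legendre n).eval (Real.cos x) : ℝ) : ℂ) =
      -(Complex.I / π) * ∫ y in x..(2 * π - x),
        Complex.exp (Complex.I * (n + 1 / 2) * y) /
          (Real.sqrt (2 * (Real.cos x - Real.cos y)) : ℂ) := by
  rw [dm_main_sub n x hx, dm_main_eval n]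
  · have e2 : cos x = 2 * (cos (x/2))^2 - 1 := by
      rw [← cos_two_mul]; congr 1; ring
    rw [e2, dm_legendre]
    have hp : (π : ℂ) ≠ 0 := by exact_mod_cast pi_ne_zero
    rw [Complex.ofReal_mul, Complex.ofReal_mul π]
    generalize ((∑ k ∈ Finset.range (n+1), (-1:ℝ)^k * n.choose k * (n+k).choose n * (cos (x/2)^2)^k : ℝ) : ℂ) = s
    push_cast
    field_simp
    linear_combination s * Complex.I_sq
  · exact cos_pos_of_mem_Ioo ⟨by linarith [hx.1, pi_pos], by linarith [hx.2]⟩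
  · rw [← cos_zero]
    exact cos_lt_cos_of_nonneg_of_le_pi (le_refl _) (by linarith [hx.2, hx.1]) (by linarith [hx.1])
end

section
/- Let f : [−1,1] → ℝ be integrable and set φ(y) = ∫_{cos y}^{1} f(x)/√(2(x − cos y)) dx for y ∈ [0, π]. Then for every integer n ≥ 0, the Legendre coefficient c_n = (n+1/2) ∫_{−1}^{1} f(x) P_n(x) dx equals (2/π)(n + 1/2) ∫_0^π φ(y) sin((n + 1/2) y) dy. -/
open MeasureTheory Real intervalIntegral

noncomputable def GG (n : ℕ) : Polynomial ℝ :=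
  ∑ k ∈ Finset.range (n+1), Polynomial.monomial k ((-1:ℝ)^(n+k) * ((n+k).choose (2*k) : ℝ) * 4^k)

lemma GG_coeff (n k : ℕ) : (GG n).coeff k = (-1:ℝ)^(n+k) * ((n+k).choose (2*k) : ℝ) * 4^k := by
  simp only [GG, Polynomial.finsetSum_coeff, Polynomial.coeff_monomial]
  rw [Finset.sum_ite_eq' ]
  split_ifs with h
  · rfl
  · rw [Nat.choose_eq_zero_of_lt]
    · simp
    · simp at h; omega

lemma GG_rec (n : ℕ) : GG (n+2) = (4 * Polynomial.X - 2) * GG (n+1) - GG n := by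
  ext k
  have e : (4 * Polynomial.X - 2) * GG (n+1) - GG n
    = Polynomial.C 4 * (Polynomial.X * GG (n+1)) - Polynomial.C 2 * GG (n+1) - GG n := by
    simp only [Polynomial.C_ofNat]; ring
  rw [e]
  simp only [Polynomial.coeff_sub, Polynomial.coeff_C_mul]
  rcases k with _ | k
  · simp [GG_coeff]; ring
  · rw [Polynomial.coeff_X_mul]
    simp only [GG_coeff]
    have h : ((n+2+(k+1)).choose (2*(k+1)) : ℝ) = ((n+1+k).choose (2*k) : ℝ)
        + 2 * ((n+1+(k+1)).choose (2*(k+1)) : ℝ) - ((n+(k+1)).choose (2*(k+1)) : ℝ) := by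
      have h1 : n+2+(k+1) = (n+k+2)+1 := by ring
      have h2 : n+1+(k+1) = (n+k+1)+1 := by ring
      have h3 : n+(k+1) = n+k+1 := by ring
      have h4 : n+1+k = n+k+1 := by ring
      have h5 : 2*(k+1) = (2*k+1)+1 := by ring
      rw [h1,h2,h3,h4,h5, Nat.choose_succ_succ, Nat.choose_succ_succ (n+k+1),
        Nat.choose_succ_succ (n+k+1)]
      push_cast; ring
    rw [h]; ring

lemma sin_GG (n : ℕ) (a : ℝ) : sin ((2*n+1)*a) = sin a * (GG n).eval (cos a ^ 2) := by
  induction n using Nat.twoStepInduction with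
  | zero => simp [GG]
  | one =>
    simp [GG, Finset.sum_range_succ, Polynomial.eval_add]
    norm_num
    rw [sin_three_mul, ← sub_eq_zero]
    have := sin_sq a
    linear_combination (-4 * sin a) * this
  | more n h0 h1 =>
    rw [GG_rec]
    simp only [Polynomial.eval_sub, Polynomial.eval_mul, Polynomial.eval_X, Polynomial.eval_ofNat]
    rw [mul_sub, ← h0, mul_left_comm, ← h1]
    push_cast
    have e : sin ((2*(n+2)+1)*a) + sin ((2*n+1)*a) = 2 * sin ((2*(n+1)+1)*a) * cos (2*a) := by
      rw [show (2*((n:ℝ)+2)+1)*a = (2*(n+1)+1)*a + 2*a by ring,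
        show (2*(n:ℝ)+1)*a = (2*(n+1)+1)*a - 2*a by ring, sin_add, sin_sub]; ring
    rw [cos_two_mul] at e
    linear_combination e

lemma legendre_comp (n : ℕ) : (legendre n).comp (2 * Polynomial.X - 1)
    = (-1)^n * (Polynomial.shiftedLegendre n).map (Int.castRingHom ℝ) := by
  have key : ∀ (m : ℕ) (p : Polynomial ℝ), Polynomial.derivative^[m] (p.comp (2 * Polynomial.X - 1))
      = 2^m * (Polynomial.derivative^[m] p).comp (2 * Polynomial.X - 1) := by
    intro m
    induction m with
    | zero => intro p; simp
    | succ m ih =>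
      intro p
      rw [Function.iterate_succ_apply, Function.iterate_succ_apply, Polynomial.derivative_comp]
      have : Polynomial.derivative (2 * Polynomial.X - 1 : Polynomial ℝ) = Polynomial.C 2 := by
        simp [Polynomial.C_ofNat]
      rw [this, Polynomial.iterate_derivative_C_mul, ih]
      simp only [Polynomial.C_ofNat]; ring
  have h := congrArg (Polynomial.map (Int.castRingHom ℝ)) (Polynomial.factorial_mul_shiftedLegendre_eq n)
  simp only [Polynomial.map_mul, Polynomial.map_natCast, ← Polynomial.iterate_derivative_map, Polynomial.map_pow, Polynomial.map_sub,
    Polynomial.map_X, Polynomial.map_one] at h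
  have k := key n ((Polynomial.X ^ 2 - 1) ^ n)
  have e : ((Polynomial.X ^ 2 - 1 : Polynomial ℝ) ^ n).comp (2 * Polynomial.X - 1)
     = Polynomial.C ((-4)^n) * (Polynomial.X ^ n * (1 - Polynomial.X) ^ n) := by
    simp only [Polynomial.pow_comp, Polynomial.sub_comp, Polynomial.X_comp, Polynomial.one_comp]
    rw [← mul_pow, Polynomial.C_pow, ← mul_pow]
    congr 1
    simp only [map_neg, Polynomial.C_ofNat]
    ring
  rw [e, Polynomial.iterate_derivative_C_mul, ← h] at k
  simp only [legendre, Polynomial.smul_comp]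
  have k2 : (Polynomial.derivative^[n] ((Polynomial.X ^ 2 - 1 : Polynomial ℝ) ^ n)).comp (2 * Polynomial.X - 1) =
     Polynomial.C ((1/2)^n : ℝ) * (Polynomial.C ((-4)^n) * ((n.factorial : Polynomial ℝ) * (Polynomial.shiftedLegendre n).map (Int.castRingHom ℝ))) := by
    rw [k, ← mul_assoc, show (2:Polynomial ℝ)^n = Polynomial.C (2^n) by simp [Polynomial.C_ofNat], ← Polynomial.C_mul, ← mul_pow]
    norm_num
  rw [k2, Polynomial.smul_eq_C_mul, ← mul_assoc, ← mul_assoc, ← mul_assoc,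
    show (n.factorial : Polynomial ℝ) = Polynomial.C (n.factorial : ℝ) by simp,
    show (-1 : Polynomial ℝ)^n = Polynomial.C ((-1)^n) by simp, ← Polynomial.C_mul, ← Polynomial.C_mul, ← Polynomial.C_mul]
  congr 2
  have : (n.factorial : ℝ) ≠ 0 := by positivity
  rw [show (-4:ℝ)^n = (-1)^n * 2^n * 2^n by rw [← mul_pow, ← mul_pow]; norm_num]
  field_simp
  rw [div_pow]; field_simp; simp

lemma wallis (k : ℕ) : ∫ t in (0:ℝ)..(π/2), sin t ^ (2*k) = π/2 * (k.centralBinom / 4^k) := by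
  induction k with
  | zero => simp
  | succ k ih =>
    rw [show 2*(k+1) = 2*k+2 by ring, integral_sin_pow, ih]
    have := Nat.succ_mul_centralBinom_succ k
    have h : ((k:ℝ)+1) * (k+1).centralBinom = 2*(2*k+1)*k.centralBinom := by exact_mod_cast this
    simp
    rw [pow_succ]
    field_simp
    linear_combination (-2) * h

lemma legendre_int (n : ℕ) (c : ℝ) :
    ∫ t in (0:ℝ)..(π/2), (GG n).eval ((c * sin t)^2) = π/2 * (legendre n).eval (2*c^2-1) := by
  have h := congrArg (Polynomial.eval (c^2)) (legendre_comp n)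
  simp only [Polynomial.eval_comp, Polynomial.eval_sub, Polynomial.eval_mul, Polynomial.eval_X, Polynomial.eval_ofNat, Polynomial.eval_one, Polynomial.eval_pow, Polynomial.eval_neg] at h
  rw [h]
  simp only [GG, Polynomial.eval_finsetSum, Polynomial.eval_monomial]
  rw [intervalIntegral.integral_finsetSum]
  · simp only [Polynomial.shiftedLegendre, Polynomial.map_sum, Polynomial.eval_finsetSum]
    rw [Finset.mul_sum, Finset.mul_sum]
    refine Finset.sum_congr rfl fun k hk => ?_
    have hk : k ≤ n := by simp at hk; omega
    have : ∀ t, (-1:ℝ)^(n+k) * ((n+k).choose (2*k) : ℝ) * 4^k * ((c * sin t)^2)^k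
       = ((-1:ℝ)^(n+k) * ((n+k).choose (2*k) : ℝ) * 4^k * c^(2*k)) * sin t^(2*k) := by
      intro t; rw [← pow_mul, mul_pow]; ring
    simp only [this]
    rw [intervalIntegral.integral_const_mul, wallis]
    have hc : ((n+k).choose (2*k) : ℝ) * k.centralBinom = n.choose k * (n+k).choose n := by
      rw [Nat.centralBinom_eq_two_mul_choose]
      have := Nat.choose_mul (n := n+k) (k := 2*k) (s := k) (by omega)
      rw [show n+k-k = n by omega, show 2*k-k=k by omega, Nat.choose_symm_add.symm] at this
      rw [mul_comm ((n.choose k : ℕ) : ℝ)]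
      exact_mod_cast this
    simp
    rw [pow_add, pow_mul]
    field_simp
    linear_combination (c^(2*k)) * hc
  · intro k _
    apply Continuous.intervalIntegrable
    fun_prop

lemma mehler (n : ℕ) (c : ℝ) (hc0 : 0 < c) (hc1 : c < 1) (g : ℝ → ℝ)
    (hg : ∀ y, g y = sin ((n+1/2)*y) / √(2*((2*c^2-1) - cos y))) :
    IntegrableOn g (Set.Ioc 0 π) ∧
    ∫ y in Set.Ioc 0 π, g y = ∫ t in (0:ℝ)..(π/2), (GG n).eval ((c * sin t)^2) ∧
    ∫ y in Set.Ioc 0 π, ‖g y‖ = ∫ t in (0:ℝ)..(π/2), |(GG n).eval ((c * sin t)^2)| := by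
  have hpi := pi_pos
  have hs : ∀ t ∈ Set.Ioo 0 (π/2), 0 < sin t ∧ sin t < 1 ∧ 0 < cos t := by
    intro t ht
    have h1 : 0 < cos t := cos_pos_of_mem_Ioo ⟨by linarith [ht.1], ht.2⟩
    have h0 : 0 < sin t := sin_pos_of_pos_of_lt_pi ht.1 (by linarith [ht.2])
    refine ⟨h0, ?_, h1⟩
    nlinarith [sin_sq_add_cos_sq t]
  have hcs : ∀ t ∈ Set.Ioo 0 (π/2), 0 < c * sin t ∧ c * sin t < c := by
    intro t ht
    obtain ⟨h0, h1, h2⟩ := hs t ht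
    exact ⟨by positivity, by nlinarith⟩
  set Y : ℝ → ℝ := fun t => 2 * arccos (c * sin t) with hY
  set Y' : ℝ → ℝ := fun t => 2 * (-(1 / √(1 - (c * sin t)^2)) * (c * cos t)) with hY'
  have hder : ∀ t ∈ Set.Ioo 0 (π/2), HasDerivWithinAt Y (Y' t) (Set.Ioo 0 (π/2)) t := by
    intro t ht
    obtain ⟨h0, h1⟩ := hcs t ht
    have := (hasDerivAt_arccos (x := c * sin t) (by linarith) (by linarith)).comp t
      ((hasDerivAt_sin t).const_mul c)
    exact (this.const_mul 2).hasDerivWithinAt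
  have hinj : Set.InjOn Y (Set.Ioo 0 (π/2)) := by
    intro t ht u hu htu
    have h : arccos (c * sin t) = arccos (c * sin u) := by
      simp only [hY] at htu; linarith
    have := arccos_injOn ⟨by linarith [hcs t ht], by linarith [hcs t ht]⟩
      ⟨by linarith [hcs u hu], by linarith [hcs u hu]⟩ h
    have h2 : sin t = sin u := mul_left_cancel₀ hc0.ne' this
    exact injOn_sin ⟨by linarith [ht.1], ht.2.le⟩ ⟨by linarith [hu.1], hu.2.le⟩ h2
  have hθ0 : 0 ≤ 2 * arccos c := by linarith [arccos_nonneg c]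
  have himg : Y '' Set.Ioo 0 (π/2) = Set.Ioo (2 * arccos c) π := by
    ext y
    constructor
    · rintro ⟨t, ht, rfl⟩
      obtain ⟨h0, h1⟩ := hcs t ht
      have a1 : arccos c < arccos (c * sin t) := arccos_lt_arccos (by linarith) h1 hc1.le
      have a2 : arccos (c * sin t) < π/2 := arccos_lt_pi_div_two.2 h0
      constructor <;> simp only [hY] <;> linarith
    · rintro ⟨h1, h2⟩
      have b0 : 0 < cos (y/2) := cos_pos_of_mem_Ioo ⟨by linarith, by linarith⟩
      have b1 : cos (y/2) < c := by
        rw [← cos_arccos (x := c) (by linarith) hc1.le]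
        exact cos_lt_cos_of_nonneg_of_le_pi (arccos_nonneg c) (by linarith) (by linarith)
      have b2 : cos (y/2) / c < 1 := (div_lt_one hc0).2 b1
      have b3 : 0 < cos (y/2) / c := by positivity
      refine ⟨arcsin (cos (y/2) / c), ⟨arcsin_pos.2 b3, arcsin_lt_pi_div_two.2 b2⟩, ?_⟩
      simp only [hY]
      rw [sin_arcsin (by linarith) b2.le, mul_div_cancel₀ _ hc0.ne', arccos_cos (by linarith) (by linarith)]
      ring
  have hpt : ∀ t ∈ Set.Ioo 0 (π/2), |Y' t| * g (Y t) = (GG n).eval ((c * sin t)^2) := by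
    intro t ht
    obtain ⟨h0, h1⟩ := hcs t ht
    obtain ⟨_, _, h3⟩ := hs t ht
    have hr : 0 < √(1 - (c * sin t)^2) := sqrt_pos.2 (by nlinarith)
    have e1 : cos (arccos (c * sin t)) = c * sin t := cos_arccos (by linarith) (by linarith)
    have e2 : sin (arccos (c * sin t)) = √(1 - (c * sin t)^2) := sin_arccos _
    have e3 : sin ((n+1/2) * Y t) = √(1 - (c * sin t)^2) * (GG n).eval ((c * sin t)^2) := by
      have := sin_GG n (arccos (c * sin t))
      rw [e1, e2] at this
      rw [← this]; congr 1; simp only [hY]; ring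
    have e4 : √(2*((2*c^2-1) - cos (Y t))) = 2 * (c * cos t) := by
      simp only [hY]
      rw [cos_two_mul, e1, show 2*((2*c^2-1) - (2*(c * sin t)^2-1)) = (2 * (c * cos t))^2 by
        have := sin_sq_add_cos_sq t
        linear_combination (-4*c^2) * this]
      exact sqrt_sq (by positivity)
    have e5 : |Y' t| = 2 * (c * cos t) / √(1 - (c * sin t)^2) := by
      simp only [hY']
      rw [show 2 * (-(1 / √(1 - (c * sin t)^2)) * (c * cos t)) = -(2 * (c * cos t) / √(1 - (c * sin t)^2)) by ring, abs_neg]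
      exact abs_of_nonneg (by positivity)
    have h6 : c * cos t ≠ 0 := by positivity
    have h7 := hr.ne'
    rw [e5, hg, e3, e4]
    generalize √(1 - (c * sin t)^2) = r at *
    generalize (GG n).eval ((c * sin t)^2) = q at *
    field_simp
  have hz : ∀ y ∈ Set.Ioo 0 π \ Set.Ioo (2 * arccos c) π, g y = 0 := by
    rintro y ⟨⟨h1, h2⟩, h3⟩
    have h4 : y ≤ 2 * arccos c := by
      by_contra h; exact h3 ⟨not_le.1 h, h2⟩
    have h5 : c ≤ cos (y/2) := by
      rw [← cos_arccos (x := c) (by linarith) hc1.le]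
      exact cos_le_cos_of_nonneg_of_le_pi (by linarith) (arccos_le_pi c) (by linarith)
    have h6 : cos y = 2 * cos (y/2)^2 - 1 := by rw [← cos_two_mul]; congr 1; ring
    rw [hg, sqrt_eq_zero_of_nonpos, div_zero]
    rw [h6]; nlinarith
  have hsub : Set.Ioo (2 * arccos c) π ⊆ Set.Ioo 0 π := Set.Ioo_subset_Ioo_left hθ0
  have hcont : Continuous fun t => (GG n).eval ((c * sin t)^2) := by fun_prop
  refine ⟨?_, ?_, ?_⟩
  · rw [integrableOn_Ioc_iff_integrableOn_Ioo]
    refine IntegrableOn.of_forall_sdiff_eq_zero (s := Set.Ioo (2 * arccos c) π) ?_ measurableSet_Ioo hz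
    rw [← himg, integrableOn_image_iff_integrableOn_abs_deriv_smul measurableSet_Ioo hder hinj]
    refine IntegrableOn.congr_fun (f := fun t => (GG n).eval ((c * sin t)^2)) ?_ ?_ measurableSet_Ioo
    · exact (hcont.integrableOn_Icc).mono_set Set.Ioo_subset_Icc_self
    · intro t ht; exact (hpt t ht).symm
  · rw [integral_Ioc_eq_integral_Ioo, setIntegral_eq_of_subset_of_forall_sdiff_eq_zero measurableSet_Ioo hsub hz,
      ← himg, integral_image_eq_integral_abs_deriv_smul measurableSet_Ioo hder hinj,
      intervalIntegral.integral_of_le (by positivity), integral_Ioc_eq_integral_Ioo]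
    exact setIntegral_congr_fun measurableSet_Ioo hpt
  · rw [integral_Ioc_eq_integral_Ioo, setIntegral_eq_of_subset_of_forall_sdiff_eq_zero measurableSet_Ioo hsub
        (fun y hy => by rw [hz y hy, norm_zero]),
      ← himg, integral_image_eq_integral_abs_deriv_smul measurableSet_Ioo hder hinj,
      intervalIntegral.integral_of_le (by positivity), integral_Ioc_eq_integral_Ioo]
    refine setIntegral_congr_fun measurableSet_Ioo fun t ht => ?_
    simp only [smul_eq_mul]
    rw [← hpt t ht, abs_mul (|Y' t|), abs_abs, Real.norm_eq_abs]

lemma GG_bound (n : ℕ) : ∃ C : ℝ, ∀ c : ℝ, 0 < c → c < 1 →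
    ∫ t in (0:ℝ)..(π/2), |(GG n).eval ((c * sin t)^2)| ≤ C := by
  obtain ⟨B, hB⟩ := (isCompact_Icc (a := (0:ℝ)) (b := 1)).exists_bound_of_continuousOn
    (f := fun s => (GG n).eval s) (by fun_prop)
  refine ⟨B * |π/2 - 0|, fun c h0 h1 => ?_⟩
  refine (le_abs_self _).trans ?_
  rw [← Real.norm_eq_abs]
  refine intervalIntegral.norm_integral_le_of_norm_le_const fun t _ => ?_
  have := hB ((c * sin t)^2) ⟨by positivity, by
    rw [mul_pow]
    have h2 := sin_sq_le_one t
    have h3 : c^2 ≤ 1 := by nlinarith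
    nlinarith [sq_nonneg c, sq_nonneg (sin t)]⟩
  simpa using this

theorem legendre_coeff_eq_half_integer_sine_transform
    (f : ℝ → ℝ) (hf : IntegrableOn f (Set.Icc (-1) 1))
    (φ : ℝ → ℝ)
    (hφ : ∀ y ∈ Set.Icc 0 π, φ y =
      ∫ x in Real.cos y..1, f x / Real.sqrt (2 * (x - Real.cos y))) :
    ∀ n : ℕ, (n + 1 / 2 : ℝ) * ∫ x in (-1 : ℝ)..1, f x * (legendre n).eval x =
      (2 / π) * (n + 1 / 2) * ∫ y in (0 : ℝ)..π, φ y * Real.sin ((n + 1 / 2) * y) := by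
  intro n
  have hpi := pi_pos
  obtain ⟨C, hC⟩ := GG_bound n
  let k : ℝ → ℝ → ℝ := fun x y => sin ((n+1/2)*y) / √(2*(x - cos y))
  have hk : ∀ x ∈ Set.Ioo (-1:ℝ) 1, IntegrableOn (k x) (Set.Ioc 0 π) ∧
      ∫ y in Set.Ioc 0 π, k x y = π/2 * (legendre n).eval x ∧
      ∫ y in Set.Ioc 0 π, ‖k x y‖ ≤ C := by
    rintro x ⟨hx0, hx1⟩
    have hc : 2 * √((1+x)/2)^2 - 1 = x := by rw [sq_sqrt (by linarith)]; ring
    have hc0 : 0 < √((1+x)/2) := sqrt_pos.2 (by linarith)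
    have hc1 : √((1+x)/2) < 1 := by
      rw [sqrt_lt' one_pos]; linarith
    obtain ⟨h1, h2, h3⟩ := mehler n _ hc0 hc1 (k x) (fun y => by rw [hc])
    refine ⟨h1, ?_, ?_⟩
    · rw [h2, legendre_int, hc]
    · rw [h3]; exact hC _ hc0 hc1
  have hf' : IntegrableOn f (Set.Ioo (-1) 1) := hf.mono_set Set.Ioo_subset_Icc_self
  have hkm : Measurable (Function.uncurry k) := by
    unfold Function.uncurry; simp only [k]; fun_prop
  have hmeas : AEStronglyMeasurable (Function.uncurry fun x y => f x * k x y)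
      ((volume.restrict (Set.Ioo (-1:ℝ) 1)).prod (volume.restrict (Set.Ioc 0 π))) := by
    exact (hf'.aestronglyMeasurable.comp_fst).mul hkm.aestronglyMeasurable
  have hint : Integrable (Function.uncurry fun x y => f x * k x y)
      ((volume.restrict (Set.Ioo (-1:ℝ) 1)).prod (volume.restrict (Set.Ioc 0 π))) := by
    rw [integrable_prod_iff hmeas]
    constructor
    · filter_upwards [ae_restrict_mem measurableSet_Ioo] with x hx
      exact ((hk x hx).1).const_mul (f x)
    · refine Integrable.mono' (g := fun x => ‖f x‖ * C) (hf'.norm.mul_const C)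
        hmeas.norm.integral_prod_right' ?_
      filter_upwards [ae_restrict_mem measurableSet_Ioo] with x hx
      simp only [Function.uncurry, norm_mul]
      rw [MeasureTheory.integral_const_mul, norm_mul, norm_norm]
      rw [Real.norm_of_nonneg (integral_nonneg fun _ => norm_nonneg _)]
      exact mul_le_mul_of_nonneg_left (hk x hx).2.2 (norm_nonneg _)
  have hswap := integral_integral_swap hint
  have hL : ∫ x in Set.Ioo (-1:ℝ) 1, ∫ y in Set.Ioc 0 π, f x * k x y
      = π/2 * ∫ x in (-1:ℝ)..1, f x * (legendre n).eval x := by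
    rw [intervalIntegral.integral_of_le (by norm_num), integral_Ioc_eq_integral_Ioo, ← MeasureTheory.integral_const_mul]
    refine setIntegral_congr_fun measurableSet_Ioo fun x hx => ?_
    rw [MeasureTheory.integral_const_mul, (hk x hx).2.1]; ring
  have hR : ∫ y in Set.Ioc 0 π, ∫ x in Set.Ioo (-1:ℝ) 1, f x * k x y
      = ∫ y in (0:ℝ)..π, φ y * sin ((n+1/2)*y) := by
    rw [intervalIntegral.integral_of_le hpi.le]
    refine setIntegral_congr_fun measurableSet_Ioc fun y hy => ?_
    rw [hφ y ⟨hy.1.le, hy.2⟩, intervalIntegral.integral_of_le (cos_le_one y), ← MeasureTheory.integral_mul_const,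
      ← integral_Ioc_eq_integral_Ioo]
    rw [setIntegral_eq_of_subset_of_forall_sdiff_eq_zero measurableSet_Ioc
      (Set.Ioc_subset_Ioc_left (neg_one_le_cos y))]
    · refine setIntegral_congr_fun measurableSet_Ioc fun x hx => ?_
      simp only [k]; ring
    · rintro x ⟨hx1, hx2⟩
      have : x ≤ cos y := by
        by_contra h; exact hx2 ⟨not_le.1 h, hx1.2⟩
      simp only [k]
      rw [sqrt_eq_zero_of_nonpos (by linarith)]; simp
  rw [hL, hR] at hswap
  rw [← hswap]
  field_simp
end
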